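/- arXiv:0903.0284 — 2 statements merged into one kernel-verified Lean document; each statement's English description precedes it below -/
import Mathlib

section
/- For real numbers x, y with 0 < y < x < 1, Rogers' dilogarithm L(t) := −(1/2)·log(t)·log(1/(1−t)) − ∫₀ᵗ log(1−s)/s ds − π²/6 (defined for t ∈ (0,1)) satisfies the five term functional equation L(x) − L(y) + L(y/x) − L((1−x⁻¹)/(1−y⁻¹)) + L((1−x)/(1−y)) = 0. (All five arguments lie in (0,1).) -/
/-- Rogers' dilogarithm (normalized by subtracting `π²/6`). -/
noncomputable def rogersL (t : ℝ) : ℝ :=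
  -(1/2) * Real.log t * Real.log (1 / (1 - t))
    - (∫ s in (0:ℝ)..t, Real.log (1 - s) / s) - Real.pi ^ 2 / 6

open MeasureTheory in
theorem integral_log_one_sub_div_self :
    (∫ s in (0:ℝ)..1, Real.log (1 - s) / s) = -(Real.pi ^ 2 / 6) := by
  have hint : ∀ n : ℕ, ∫ s in Set.Ioo (0:ℝ) 1, s ^ n / (n + 1) = 1 / ((n : ℝ) + 1) ^ 2 := by
    intro n
    rw [← integral_Ioc_eq_integral_Ioo, ← intervalIntegral.integral_of_le zero_le_one,
      intervalIntegral.integral_div, integral_pow]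
    field_simp
    simp
  have hzeta : HasSum (fun n : ℕ => 1 / ((n : ℝ) + 1) ^ 2) (Real.pi ^ 2 / 6) := by
    have h := (hasSum_nat_add_iff' 1).2 hasSum_zeta_two
    simpa using h
  have hnorm : ∀ n : ℕ, ∫ s in Set.Ioo (0:ℝ) 1, ‖s ^ n / ((n : ℝ) + 1)‖
      = 1 / ((n : ℝ) + 1) ^ 2 := by
    intro n
    rw [← hint n]
    refine setIntegral_congr_fun measurableSet_Ioo fun s hs => ?_
    have := hs.1
    exact Real.norm_of_nonneg (by positivity)
  have hsum := hasSum_integral_of_summable_integral_norm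
    (μ := volume.restrict (Set.Ioo (0:ℝ) 1)) (F := fun (n : ℕ) (s : ℝ) => s ^ n / ((n : ℝ) + 1))
    (fun n => ((by fun_prop : Continuous fun s : ℝ => s ^ n / ((n : ℝ) + 1)).integrableOn_Icc
      (a := 0) (b := 1)).mono_set Set.Ioo_subset_Icc_self)
    (by simpa only [hnorm] using hzeta.summable)
  simp only [hint] at hsum
  have hlog : ∫ s in Set.Ioo (0:ℝ) 1, ∑' n : ℕ, s ^ n / ((n : ℝ) + 1)
      = ∫ s in Set.Ioo (0:ℝ) 1, -(Real.log (1 - s) / s) := by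
    refine setIntegral_congr_fun measurableSet_Ioo fun s hs => ?_
    have hs0 := hs.1.ne'
    have h := (Real.hasSum_pow_div_log_of_abs_lt_one
      (abs_lt.2 ⟨by linarith [hs.1], hs.2⟩)).div_const s
    refine HasSum.tsum_eq ?_
    convert! h using 1
    · ext n
      field_simp
      ring
    · ring
  rw [hlog] at hsum
  rw [intervalIntegral.integral_of_le zero_le_one, integral_Ioc_eq_integral_Ioo,
    hzeta.unique hsum, integral_neg, neg_neg]

open MeasureTheory in
theorem intervalIntegrable_log_one_sub_div_self :
    IntervalIntegrable (fun s : ℝ => Real.log (1 - s) / s) volume 0 1 := by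
  by_contra h
  have h1 := intervalIntegral.integral_undef h
  rw [integral_log_one_sub_div_self] at h1
  have := Real.pi_pos
  have : 0 < Real.pi ^ 2 / 6 := by positivity
  linarith

theorem hasDerivAt_rogersL {t : ℝ} (h0 : 0 < t) (h1 : t < 1) :
    HasDerivAt rogersL (-(1/2) * (Real.log (1 - t) / t + Real.log t / (1 - t))) t := by
  have ht : 1 - t ≠ 0 := by linarith
  have hlog : HasDerivAt (fun s : ℝ => Real.log (1 - s)) (-1 / (1 - t)) t :=
    ((hasDerivAt_id t).const_sub 1).log ht
  have hint : HasDerivAt (fun u : ℝ => ∫ s in (0:ℝ)..u, Real.log (1 - s) / s)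
      (Real.log (1 - t) / t) t := by
    refine intervalIntegral.integral_hasDerivAt_right
      (intervalIntegrable_log_one_sub_div_self.mono_set ?_) ?_
      (hlog.continuousAt.div continuousAt_id h0.ne')
    · rw [Set.uIcc_of_le h0.le, Set.uIcc_of_le zero_le_one]
      exact Set.Icc_subset_Icc_right h1.le
    · exact (Measurable.stronglyMeasurable (by fun_prop)).stronglyMeasurableAtFilter
  have hmain := ((((Real.hasDerivAt_log h0.ne').mul hlog).const_mul (1/2)).sub hint).sub_const
    (Real.pi ^ 2 / 6)
  refine (hmain.congr_of_eventuallyEq (.of_forall fun s => ?_)).congr_deriv ?_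
  · simp only [rogersL, one_div, Real.log_inv, Pi.mul_apply, Pi.sub_apply]
    ring
  · field_simp
    ring

open Filter Topology in
theorem tendsto_log_mul_log_one_sub :
    Tendsto (fun t : ℝ => Real.log t * Real.log (1 - t)) (𝓝[<] 1) (𝓝 0) := by
  have hbound : Tendsto (fun t : ℝ => -((1 - t) * Real.log (1 - t)) / t) (𝓝[<] 1) (𝓝 0) := by
    have hc : ContinuousAt (fun t : ℝ => -((1 - t) * Real.log (1 - t)) / t) 1 :=
      ((Real.continuous_mul_log.comp (continuous_const.sub continuous_id)).neg.continuousAt).div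
        continuousAt_id one_ne_zero
    simpa using hc.tendsto.mono_left nhdsWithin_le_nhds
  have hmem : Set.Ioo (0:ℝ) 1 ∈ 𝓝[<] (1:ℝ) := Ioo_mem_nhdsLT zero_lt_one
  refine tendsto_of_tendsto_of_tendsto_of_le_of_le' tendsto_const_nhds hbound ?_ ?_
  · filter_upwards [hmem] with t ht
    exact mul_nonneg_of_nonpos_of_nonpos (Real.log_nonpos ht.1.le ht.2.le)
      (Real.log_nonpos (by linarith [ht.2]) (by linarith [ht.1]))
  · filter_upwards [hmem] with t ht
    have hl : Real.log (1 - t) ≤ 0 := Real.log_nonpos (by linarith [ht.2]) (by linarith [ht.1])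
    have ht0 := ht.1.ne'
    calc Real.log t * Real.log (1 - t) ≤ (1 - t⁻¹) * Real.log (1 - t) :=
          mul_le_mul_of_nonpos_right (Real.one_sub_inv_le_log_of_pos ht.1) hl
      _ = -((1 - t) * Real.log (1 - t)) / t := by field_simp; ring

open Filter Topology in
theorem tendsto_rogersL_one : Tendsto rogersL (𝓝[<] 1) (𝓝 0) := by
  have hint : Tendsto (fun u : ℝ => ∫ s in (0:ℝ)..u, Real.log (1 - s) / s) (𝓝[<] 1)
      (𝓝 (-(Real.pi ^ 2 / 6))) := by
    rw [← integral_log_one_sub_div_self]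
    have hc := intervalIntegral.continuousOn_primitive_interval'
      intervalIntegrable_log_one_sub_div_self Set.left_mem_uIcc 1 Set.right_mem_uIcc
    rw [Set.uIcc_of_le zero_le_one] at hc
    refine hc.tendsto.mono_left (nhdsWithin_le_iff.2 ?_)
    exact mem_of_superset (Ioo_mem_nhdsLT zero_lt_one) Set.Ioo_subset_Icc_self
  have h := ((tendsto_log_mul_log_one_sub.const_mul (1/2)).sub hint).sub_const (Real.pi ^ 2 / 6)
  have h0 : 1 / 2 * 0 - -(Real.pi ^ 2 / 6) - Real.pi ^ 2 / 6 = 0 := by ring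
  rw [h0] at h
  refine h.congr fun t => ?_
  simp only [rogersL, one_div, Real.log_inv]
  ring

theorem hasDerivAt_rogersL_five_term {x y : ℝ} (hy : 0 < y) (hyx : y < x) (hx : x < 1) :
    HasDerivAt (fun z => rogersL x - rogersL z + rogersL (z / x)
      - rogersL (z * (1 - x) / (x * (1 - z))) + rogersL ((1 - x) / (1 - z))) 0 y := by
  have hx0 : 0 < x := hy.trans hyx
  have hx1 : 0 < 1 - x := by linarith
  have hy1 : 0 < 1 - y := by linarith
  have hxy : 0 < x - y := by linarith
  have hb : y * (1 - x) / (x * (1 - y)) < 1 := by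
    rw [div_lt_one (by positivity)]; nlinarith
  have hc : (1 - x) / (1 - y) < 1 := by rw [div_lt_one hy1]; linarith
  have dsub : HasDerivAt (fun z : ℝ => 1 - z) (-1) y := (hasDerivAt_id y).const_sub 1
  have da : HasDerivAt (fun z : ℝ => z / x) (1 / x) y := (hasDerivAt_id y).div_const x
  have db : HasDerivAt (fun z : ℝ => z * (1 - x) / (x * (1 - z)))
      ((1 * (1 - x) * (x * (1 - y)) - y * (1 - x) * (x * -1)) / (x * (1 - y)) ^ 2) y :=
    ((hasDerivAt_id y).mul_const (1 - x)).div (dsub.const_mul x) (by positivity)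
  have dc : HasDerivAt (fun z : ℝ => (1 - x) / (1 - z))
      ((0 * (1 - y) - (1 - x) * -1) / (1 - y) ^ 2) y :=
    (hasDerivAt_const y (1 - x)).div dsub hy1.ne'
  have h1 := hasDerivAt_rogersL hy (hyx.trans hx)
  have la := hasDerivAt_rogersL (div_pos hy hx0) ((div_lt_one hx0).2 hyx)
  have lb := hasDerivAt_rogersL (by positivity) hb
  have lc := hasDerivAt_rogersL (div_pos hx1 hy1) hc
  have h2 := HasDerivAt.comp (h₂ := rogersL) (h := fun z : ℝ => z / x) y la da
  have h3 := HasDerivAt.comp (h₂ := rogersL)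
    (h := fun z : ℝ => z * (1 - x) / (x * (1 - z))) y lb db
  have h4 := HasDerivAt.comp (h₂ := rogersL) (h := fun z : ℝ => (1 - x) / (1 - z)) y lc dc
  refine ((((h1.const_sub (rogersL x)).add h2).sub h3).add h4).congr_deriv ?_
  have ea : 1 - y / x = (x - y) / x := by field_simp
  have eb : 1 - y * (1 - x) / (x * (1 - y)) = (x - y) / (x * (1 - y)) := by field_simp; ring
  have ec : 1 - (1 - x) / (1 - y) = (x - y) / (1 - y) := by field_simp; ring
  rw [ea, eb, ec, Real.log_div hy.ne' hx0.ne', Real.log_div hxy.ne' hx0.ne',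
    Real.log_div hxy.ne' (by positivity), Real.log_div (by positivity) (by positivity),
    Real.log_div hxy.ne' hy1.ne', Real.log_div hx1.ne' hy1.ne',
    Real.log_mul hx0.ne' hy1.ne', Real.log_mul hy.ne' hx1.ne']
  field_simp
  ring

open Filter Topology in
theorem tendsto_rogersL_five_term {x : ℝ} (hx0 : 0 < x) (hx : x < 1) :
    Tendsto (fun z => rogersL x - rogersL z + rogersL (z / x)
      - rogersL (z * (1 - x) / (x * (1 - z))) + rogersL ((1 - x) / (1 - z))) (𝓝[<] x) (𝓝 0) := by
  have hx1 : 0 < 1 - x := by linarith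
  have hmem : Set.Ioo 0 x ∈ 𝓝[<] x := Ioo_mem_nhdsLT hx0
  have lim_one {f : ℝ → ℝ} (hf : ContinuousAt f x) (h1 : f x = 1)
      (hlt : ∀ z ∈ Set.Ioo 0 x, f z < 1) : Tendsto (fun z => rogersL (f z)) (𝓝[<] x) (𝓝 0) := by
    refine tendsto_rogersL_one.comp (tendsto_nhdsWithin_iff.2 ⟨?_, ?_⟩)
    · exact h1 ▸ hf.tendsto.mono_left nhdsWithin_le_nhds
    · filter_upwards [hmem] with z hz using hlt z hz
  have h1 : Tendsto rogersL (𝓝[<] x) (𝓝 (rogersL x)) :=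
    (hasDerivAt_rogersL hx0 hx).continuousAt.tendsto.mono_left nhdsWithin_le_nhds
  have h2 := lim_one (f := fun z => z / x) (by fun_prop) (div_self hx0.ne')
    fun z hz => (div_lt_one hx0).2 hz.2
  have h3 := lim_one (f := fun z => z * (1 - x) / (x * (1 - z)))
    (ContinuousAt.div (by fun_prop) (by fun_prop) (by positivity)) (div_self (by positivity))
    fun z hz => by
      have : 0 < 1 - z := by linarith [hz.2]
      rw [div_lt_one (by positivity)]
      nlinarith [hz.2]
  have h4 := lim_one (f := fun z => (1 - x) / (1 - z))
    (ContinuousAt.div (by fun_prop) (by fun_prop) hx1.ne') (div_self hx1.ne')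
    fun z hz => by
      rw [div_lt_one (by linarith [hz.2])]
      linarith [hz.2]
  simpa using (((h1.const_sub (rogersL x)).add h2).sub h3).add h4

/-- The five term functional equation of Rogers' dilogarithm for `0 < y < x < 1`. -/
theorem stmt13 (x y : ℝ) (hy : 0 < y) (hyx : y < x) (hx : x < 1) :
    rogersL x - rogersL y + rogersL (y / x)
      - rogersL ((1 - x⁻¹) / (1 - y⁻¹)) + rogersL ((1 - x) / (1 - y)) = 0 := by
  have hx0 : 0 < x := hy.trans hyx
  have hy1 : y - 1 ≠ 0 := by linarith
  have hy1' : 1 - y ≠ 0 := by linarith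
  have harg : (1 - x⁻¹) / (1 - y⁻¹) = y * (1 - x) / (x * (1 - y)) := by
    have hinv : 1 - y⁻¹ = (y - 1) / y := by field_simp
    rw [hinv]
    field_simp
    ring
  rw [harg]
  have hderiv := fun z (hz : z ∈ Set.Ioo 0 x) => hasDerivAt_rogersL_five_term hz.1 hz.2 hx
  have hlim := tendsto_rogersL_five_term hx0 hx
  refine tendsto_nhds_unique (tendsto_const_nhds.congr' ?_) hlim
  filter_upwards [Ioo_mem_nhdsLT hx0] with z hz
  exact isOpen_Ioo.is_const_of_deriv_eq_zero isPreconnected_Ioo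
    (fun w hw => (hderiv w hw).differentiableAt.differentiableWithinAt)
    (fun w hw => (hderiv w hw).deriv) ⟨hy, hyx⟩ hz
end

section
/- Let v ∈ ℂ², let n ≥ 1, and let σ be a finitely supported ℤ-linear combination of (n+1)-tuples of elements of SL(2,ℂ) such that every tuple (g₀,…,g_n) in the support of σ is v-good, i.e. det(gᵢv, gⱼv) ≠ 0 for all i ≠ j, and such that ∂σ = 0, where ∂ is the simplicial boundary ∂(g₀,…,g_n) = Σᵢ(−1)ⁱ(g₀,…,ĝᵢ,…,g_n). Then there exists a finitely supported ℤ-linear combination τ of v-good (n+2)-tuples of elements of SL(2,ℂ) with ∂τ = σ. -/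
/-- The simplicial boundary `∂ : C_{n+1}(X) → C_n(X)`,
`∂(g₀,…,g_{n+1}) = Σ_i (-1)^i (g₀,…,ĝ_i,…,g_{n+1})`. -/
noncomputable def simplicialBoundary (X : Type*) (n : ℕ) :
    ((Fin (n + 2) → X) →₀ ℤ) →ₗ[ℤ] ((Fin (n + 1) → X) →₀ ℤ) :=
  Finsupp.lift ((Fin (n + 1) → X) →₀ ℤ) ℤ (Fin (n + 2) → X) fun g =>
    ∑ i : Fin (n + 2), ((-1 : ℤ) ^ (i : ℕ)) • Finsupp.single (g ∘ i.succAbove) 1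

/-- `det(u,w) = u₁w₂ − u₂w₁` for `u, w ∈ ℂ²`. -/
noncomputable def det2 (u w : Fin 2 → ℂ) : ℂ := u 0 * w 1 - u 1 * w 0

/-- A tuple of elements of `SL(2,ℂ)` is `v`-good if `det(gᵢ v, gⱼ v) ≠ 0` for all
`i ≠ j`. -/
def VGoodTuple (v : Fin 2 → ℂ) {m : ℕ}
    (g : Fin m → Matrix.SpecialLinearGroup (Fin 2) ℂ) : Prop :=
  ∀ i j, i ≠ j →
    det2 ((g i : Matrix (Fin 2) (Fin 2) ℂ).mulVec v)
      ((g j : Matrix (Fin 2) (Fin 2) ℂ).mulVec v) ≠ 0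

/-- The cone with apex `h`: the linear map `C_{m-1}(X) → C_m(X)` prepending `h` to each tuple. -/
noncomputable def simplicialCone {X : Type*} (h : X) (m : ℕ) :
    ((Fin m → X) →₀ ℤ) →ₗ[ℤ] ((Fin (m + 1) → X) →₀ ℤ) :=
  Finsupp.lmapDomain ℤ ℤ fun g : Fin m → X => (Fin.cons h g : Fin (m + 1) → X)

theorem simplicialCone_single {X : Type*} (h : X) (m : ℕ) (g : Fin m → X) (a : ℤ) :
    simplicialCone h m (Finsupp.single g a) =
      Finsupp.single (Fin.cons h g : Fin (m + 1) → X) a := by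
  simp [simplicialCone, Finsupp.mapDomain_single]

theorem simplicialBoundary_single {X : Type*} (n : ℕ) (g : Fin (n + 2) → X) :
    simplicialBoundary X n (Finsupp.single g 1) =
      ∑ i : Fin (n + 2), ((-1 : ℤ) ^ (i : ℕ)) • Finsupp.single (g ∘ i.succAbove) 1 := by
  simp [simplicialBoundary]

theorem cons_comp_succAbove_zero {X : Type*} {n : ℕ} (h : X) (g : Fin n → X) :
    (Fin.cons h g : Fin (n + 1) → X) ∘ (0 : Fin (n + 1)).succAbove = g := by
  ext j
  simp

theorem cons_comp_succAbove_succ {X : Type*} {n : ℕ} (h : X) (g : Fin (n + 1) → X)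
    (i : Fin (n + 1)) :
    (Fin.cons h g : Fin (n + 2) → X) ∘ i.succ.succAbove = Fin.cons h (g ∘ i.succAbove) := by
  ext j
  refine Fin.cases ?_ (fun k => ?_) j <;> simp

/-- The cone is a contracting homotopy: `∂(h * σ) = σ - h * ∂σ`. -/
theorem simplicialBoundary_simplicialCone {X : Type*} (h : X) (n : ℕ)
    (σ : (Fin (n + 2) → X) →₀ ℤ) :
    simplicialBoundary X (n + 1) (simplicialCone h (n + 2) σ) =
      σ - simplicialCone h (n + 1) (simplicialBoundary X n σ) := by
  suffices H : (simplicialBoundary X (n + 1)).comp (simplicialCone h (n + 2)) =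
      LinearMap.id - (simplicialCone h (n + 1)).comp (simplicialBoundary X n) from
    LinearMap.congr_fun H σ
  refine Finsupp.lhom_ext' fun g => LinearMap.ext_ring ?_
  simp only [LinearMap.comp_apply, LinearMap.sub_apply, LinearMap.id_apply,
    Finsupp.lsingle_apply, simplicialCone_single, simplicialBoundary_single, map_sum, map_smul]
  rw [Fin.sum_univ_succ]
  simp only [cons_comp_succAbove_zero, cons_comp_succAbove_succ, Fin.val_zero, Fin.val_succ,
    pow_succ, pow_zero, one_smul, mul_neg, mul_one, neg_smul, Finset.sum_neg_distrib,
    sub_eq_add_neg]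

theorem det2_swap (u w : Fin 2 → ℂ) : det2 u w = -det2 w u := by
  simp only [det2]
  ring

/-- Finitely many nonzero vectors of `ℂ²` are simultaneously independent of some `(1, t)`. -/
theorem exists_det2_one_ne_zero (S : Finset (Fin 2 → ℂ)) (hS : ∀ w ∈ S, w ≠ 0) :
    ∃ t : ℂ, ∀ w ∈ S, det2 ![1, t] w ≠ 0 := by
  obtain ⟨t, ht⟩ := Infinite.exists_notMem_finset (S.image fun w => w 1 / w 0)
  refine ⟨t, fun w hw h => ?_⟩
  have h' : w 1 = t * w 0 := by simpa [det2, sub_eq_zero] using h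
  by_cases h0 : w 0 = 0
  · refine hS w hw (funext fun i => ?_)
    fin_cases i <;> simp [h0, h']
  · exact ht (Finset.mem_image.mpr ⟨w, hw, by rw [h', mul_div_cancel_right₀ _ h0]⟩)

/-- `SL(2,ℂ)` moves any nonzero vector to any vector `(1, t)`. -/
theorem exists_specialLinearGroup_mulVec_eq {v : Fin 2 → ℂ} (hv : v ≠ 0) (t : ℂ) :
    ∃ h : Matrix.SpecialLinearGroup (Fin 2) ℂ,
      (h : Matrix (Fin 2) (Fin 2) ℂ).mulVec v = ![1, t] := by
  obtain ⟨p, q, hpq⟩ : ∃ p q : ℂ, p * v 0 + q * v 1 = 1 := by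
    by_cases h0 : v 0 = 0
    · have h1 : v 1 ≠ 0 := fun h1 => hv (funext fun i => by fin_cases i <;> simp [h0, h1])
      exact ⟨0, (v 1)⁻¹, by simp [h1]⟩
    · exact ⟨(v 0)⁻¹, 0, by simp [h0]⟩
  refine ⟨⟨!![p, q; t * p - v 1, t * q + v 0], ?_⟩, funext fun i => ?_⟩
  · rw [Matrix.det_fin_two_of]
    linear_combination hpq
  · fin_cases i
    · simpa [Matrix.mulVec, dotProduct, Fin.sum_univ_two] using hpq
    · simp only [Matrix.mulVec, dotProduct, Fin.sum_univ_two]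
      simp
      linear_combination t * hpq

theorem VGoodTuple.mulVec_ne_zero {v : Fin 2 → ℂ} {m : ℕ}
    {g : Fin (m + 2) → Matrix.SpecialLinearGroup (Fin 2) ℂ} (hg : VGoodTuple v g)
    (i : Fin (m + 2)) : (g i : Matrix (Fin 2) (Fin 2) ℂ).mulVec v ≠ 0 := by
  intro h
  obtain ⟨j, hj⟩ := exists_ne i
  exact hg i j hj.symm (by simp [h, det2])

theorem VGoodTuple.cons {v : Fin 2 → ℂ} {m : ℕ}
    {g : Fin m → Matrix.SpecialLinearGroup (Fin 2) ℂ} (hg : VGoodTuple v g)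
    {h : Matrix.SpecialLinearGroup (Fin 2) ℂ}
    (hh : ∀ i, det2 ((h : Matrix (Fin 2) (Fin 2) ℂ).mulVec v)
      ((g i : Matrix (Fin 2) (Fin 2) ℂ).mulVec v) ≠ 0) :
    VGoodTuple v (Fin.cons h g : Fin (m + 1) → Matrix.SpecialLinearGroup (Fin 2) ℂ) := by
  intro i j
  refine Fin.cases ?_ (fun i => ?_) i <;> refine Fin.cases ?_ (fun j => ?_) j
  · exact fun hij => (hij rfl).elim
  · exact fun _ => hh j
  · intro _
    rw [det2_swap]
    exact neg_ne_zero.mpr (hh i)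
  · exact fun hij => hg i j fun e => hij (congrArg Fin.succ e)

/-- Every `v`-good cycle (of degree `≥ 1`) in `C_*^{v}(SL(2,ℂ))` is the boundary of a
`v`-good chain. -/
theorem stmt18 (v : Fin 2 → ℂ) (n : ℕ)
    (σ : (Fin (n + 2) → Matrix.SpecialLinearGroup (Fin 2) ℂ) →₀ ℤ)
    (hgood : ∀ g ∈ σ.support, VGoodTuple v g)
    (hcycle : simplicialBoundary (Matrix.SpecialLinearGroup (Fin 2) ℂ) n σ = 0) :
    ∃ τ : (Fin (n + 3) → Matrix.SpecialLinearGroup (Fin 2) ℂ) →₀ ℤ,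
      (∀ g ∈ τ.support, VGoodTuple v g) ∧
      simplicialBoundary (Matrix.SpecialLinearGroup (Fin 2) ℂ) (n + 1) τ = σ := by
  classical
  by_cases hv : v = 0
  · have hσ : σ = 0 := by
      refine Finsupp.support_eq_empty.mp (Finset.eq_empty_of_forall_notMem fun g hg => ?_)
      exact (hgood g hg).mulVec_ne_zero 0 (by simp [hv])
    exact ⟨0, by simp, by simp [hσ]⟩
  obtain ⟨t, ht⟩ := exists_det2_one_ne_zero
    (σ.support.biUnion fun g => Finset.univ.image fun i =>
      (g i : Matrix (Fin 2) (Fin 2) ℂ).mulVec v) (by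
    intro w hw
    simp only [Finset.mem_biUnion, Finset.mem_image, Finset.mem_univ, true_and] at hw
    obtain ⟨g, hg, i, rfl⟩ := hw
    exact (hgood g hg).mulVec_ne_zero i)
  obtain ⟨h, hh⟩ := exists_specialLinearGroup_mulVec_eq hv t
  refine ⟨simplicialCone h (n + 2) σ, fun g' hg' => ?_, ?_⟩
  · obtain ⟨g, hg, rfl⟩ := Finset.mem_image.mp (Finsupp.mapDomain_support hg')
    refine (hgood g hg).cons fun i => ?_
    rw [hh]
    exact ht _ (Finset.mem_biUnion.mpr
      ⟨g, hg, Finset.mem_image_of_mem _ (Finset.mem_univ i)⟩)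
  · rw [simplicialBoundary_simplicialCone, hcycle, map_zero, sub_zero]
end
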